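/- Let 0 < δ ≤ δ̄ and let C : [0,1] → Matrix (Fin D) (Fin D) ℝ be continuous with δ|y|² ≤ yᵀC(t)C(t)ᵀy ≤ δ̄|y|² for all y ∈ ℝ^D and t ∈ [0,1], Σ(t,s) := ∫_t^s C(u)C(u)ᵀ du, and Γ(t,s,y) := exp(−(1/2) yᵀΣ(t,s)⁻¹y) / ((2π)^{D/2} (det Σ(t,s))^{1/2}). Let T ∈ (0,1], α ∈ (0,1), and let f₀ : [0,T]×ℝ^D → ℝ be bounded, continuous, and with finite parabolic α-Hölder seminorm. Then for every t ∈ [0,T), d ∈ {1,…,D} and y ∈ ℝ^D, the function y ↦ ∫_t^T ∫_{ℝ^D} Γ(t,s,x−y) f₀(s,x) dx ds is partially differentiable in y_d, with ∂_{y_d} ∫_t^T ∫_{ℝ^D} Γ(t,s,x−y) f₀(s,x) dx ds = −∫_t^T ∫_{ℝ^D} (∂Γ/∂y_d)(t,s,x−y) f₀(s,x) dx ds, where ∂Γ/∂y_d denotes the partial derivative of Γ(t,s,·) in the d-th coordinate of its third argument. -/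

import Mathlib

noncomputable section

open Real Set Matrix

/-- `Sig C t s = ∫_t^s C(u) C(u)ᵀ du` (entrywise Bochner integral). -/
noncomputable def Sig {D : ℕ} (C : ℝ → Matrix (Fin D) (Fin D) ℝ) (t s : ℝ) :
    Matrix (Fin D) (Fin D) ℝ :=
  fun i j => ∫ u in t..s, (C u * (C u)ᵀ) i j

/-- Uniform ellipticity: `δ |y|² ≤ yᵀ C(t)C(t)ᵀ y ≤ δ' |y|²` for all `t ∈ [0,1]`. -/
def Ellip (D : ℕ) (δ δ' : ℝ) (C : ℝ → Matrix (Fin D) (Fin D) ℝ) : Prop :=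
  ∀ t ∈ Set.Icc (0:ℝ) 1, ∀ y : Fin D → ℝ,
    δ * (∑ i, y i ^ 2) ≤ (∑ i, ∑ j, y i * (C t * (C t)ᵀ) i j * y j) ∧
    (∑ i, ∑ j, y i * (C t * (C t)ᵀ) i j * y j) ≤ δ' * (∑ i, y i ^ 2)

/-- Euclidean norm on `ℝ^D`. -/
noncomputable def en {D : ℕ} (x : Fin D → ℝ) : ℝ := Real.sqrt (∑ i, x i ^ 2)

/-- The (inhomogeneous) Gaussian kernel
`Γ(t,s,y) = exp(-½ yᵀ Σ(t,s)⁻¹ y) / ((2π)^{D/2} det(Σ(t,s))^{1/2})`. -/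
noncomputable def Gam {D : ℕ} (C : ℝ → Matrix (Fin D) (Fin D) ℝ) (t s : ℝ)
    (y : Fin D → ℝ) : ℝ :=
  Real.exp (-(1/2) * ∑ i, ∑ j, y i * (Sig C t s)⁻¹ i j * y j) /
    ((2 * Real.pi) ^ ((D : ℝ) / 2) * Real.sqrt (Sig C t s).det)


namespace GaussKernel

open MeasureTheory

/-! ### Matrices whose quadratic form is bounded on both sides -/

section QuadraticForm

variable {n : Type*} [Fintype n] {S : Matrix n n ℝ} {a b : ℝ}

theorem dotProduct_mulVec_symm (hS : S.IsSymm) (v w : n → ℝ) :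
    v ⬝ᵥ S *ᵥ w = w ⬝ᵥ S *ᵥ v := by
  rw [Matrix.dotProduct_mulVec, dotProduct_comm, ← Matrix.mulVec_transpose, hS.eq]

variable [DecidableEq n]

theorem pow_card_le_det (hS : S.IsSymm) (ha : 0 < a)
    (hl : ∀ y, a * (y ⬝ᵥ y) ≤ y ⬝ᵥ S *ᵥ y) : a ^ Fintype.card n ≤ S.det := by
  have hH : S.IsHermitian := by
    rw [Matrix.IsHermitian, Matrix.conjTranspose_eq_transpose_of_trivial]; exact hS
  rw [hH.det_eq_prod_eigenvalues, ← Finset.card_univ, ← Finset.prod_const]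
  refine Finset.prod_le_prod (fun _ _ => ha.le) fun i _ => ?_
  have h1 := hl (hH.eigenvectorBasis i).ofLp
  have h2 : (hH.eigenvectorBasis i).ofLp ⬝ᵥ (hH.eigenvectorBasis i).ofLp = 1 := by
    have h3 := hH.eigenvectorBasis.orthonormal.1 i
    have h4 := real_inner_self_eq_norm_sq (hH.eigenvectorBasis i)
    rw [h3, EuclideanSpace.inner_eq_star_dotProduct] at h4
    simpa using h4
  rw [h2, mul_one] at h1
  have h5 := hH.eigenvalues_eq i
  simp only [star_trivial, RCLike.re_to_real] at h5
  simpa [h5] using h1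

theorem mulVec_inv_mulVec (hdet : 0 < S.det) (z : n → ℝ) : S *ᵥ (S⁻¹ *ᵥ z) = z := by
  rw [Matrix.mulVec_mulVec, Matrix.mul_nonsing_inv _ hdet.ne'.isUnit, Matrix.one_mulVec]

theorem mul_sq_inv_mulVec_le (hdet : 0 < S.det) (ha : 0 < a)
    (hl : ∀ y, a * (y ⬝ᵥ y) ≤ y ⬝ᵥ S *ᵥ y) (z : n → ℝ) (d : n) :
    a * (S⁻¹ *ᵥ z) d ^ 2 ≤ z ⬝ᵥ S⁻¹ *ᵥ z := by
  have h := hl (S⁻¹ *ᵥ z)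
  rw [mulVec_inv_mulVec hdet, dotProduct_comm _ z] at h
  refine le_trans (mul_le_mul_of_nonneg_left ?_ ha.le) h
  rw [sq]
  exact Finset.single_le_sum (f := fun i => (S⁻¹ *ᵥ z) i * (S⁻¹ *ᵥ z) i)
    (fun i _ => mul_self_nonneg _) (Finset.mem_univ d)

theorem dotProduct_self_div_le (hS : S.IsSymm) (hdet : 0 < S.det) (ha : 0 ≤ a) (hb : 0 < b)
    (hl : ∀ y, a * (y ⬝ᵥ y) ≤ y ⬝ᵥ S *ᵥ y) (hu : ∀ y, y ⬝ᵥ S *ᵥ y ≤ b * (y ⬝ᵥ y))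
    (z : n → ℝ) : (z ⬝ᵥ z) / b ≤ z ⬝ᵥ S⁻¹ *ᵥ z := by
  set w := S⁻¹ *ᵥ z
  have hSw : S *ᵥ w = z := mulVec_inv_mulVec hdet z
  have h0 : 0 ≤ (b⁻¹ • z - w) ⬝ᵥ S *ᵥ (b⁻¹ • z - w) :=
    le_trans (mul_nonneg ha (Finset.sum_nonneg fun i _ => mul_self_nonneg _)) (hl _)
  have hx : w ⬝ᵥ S *ᵥ z = z ⬝ᵥ z := by rw [dotProduct_mulVec_symm hS, hSw]
  simp only [Matrix.mulVec_sub, Matrix.mulVec_smul, hSw, sub_dotProduct, dotProduct_sub,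
    smul_dotProduct, dotProduct_smul, smul_eq_mul, hx] at h0
  have h1 : b⁻¹ * (b⁻¹ * (z ⬝ᵥ S *ᵥ z)) ≤ b⁻¹ * (z ⬝ᵥ z) := by
    refine mul_le_mul_of_nonneg_left ?_ (by positivity)
    rw [inv_mul_le_iff₀ hb]; exact hu z
  rw [dotProduct_comm w z] at h0
  rw [div_eq_inv_mul]
  linarith

end QuadraticForm

/-! ### Isotropic Gaussians on `ℝ^D` -/

section Isotropic

variable {D : ℕ}

theorem exp_neg_mul_dotProduct (c : ℝ) (z : Fin D → ℝ) :
    Real.exp (-c * (z ⬝ᵥ z)) = ∏ i, Real.exp (-c * z i ^ 2) := by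
  rw [← Real.exp_sum, dotProduct, Finset.mul_sum]
  simp only [sq]

theorem integrable_exp_neg_mul_dotProduct {c : ℝ} (hc : 0 < c) :
    Integrable (fun z : Fin D → ℝ => Real.exp (-c * (z ⬝ᵥ z))) := by
  simp only [exp_neg_mul_dotProduct]
  exact Integrable.fintype_prod (f := fun _ : Fin D => fun x : ℝ => Real.exp (-c * x ^ 2))
    fun _ => integrable_exp_neg_mul_sq hc

theorem integral_exp_neg_mul_dotProduct (c : ℝ) :
    ∫ z : Fin D → ℝ, Real.exp (-c * (z ⬝ᵥ z)) = √(π / c) ^ D := by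
  simp only [exp_neg_mul_dotProduct]
  rw [integral_fintype_prod_volume_eq_pow (fun x : ℝ => Real.exp (-c * x ^ 2)),
    integral_gaussian, Fintype.card_fin]

theorem exp_neg_mul_dotProduct_sub_le {c r : ℝ} (hc : 0 ≤ c) (hr : |r| ≤ 1) (d : Fin D)
    (z : Fin D → ℝ) :
    Real.exp (-c * ((z - r • Pi.single d 1) ⬝ᵥ (z - r • Pi.single d 1))) ≤
      Real.exp c * Real.exp (-(c / 2) * (z ⬝ᵥ z)) := by
  rw [← Real.exp_add, Real.exp_le_exp]
  set e : Fin D → ℝ := r • Pi.single d 1 with he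
  have hee : e ⬝ᵥ e ≤ 1 := by
    simp only [he, smul_dotProduct, dotProduct_smul, single_dotProduct, Pi.single_eq_same,
      smul_eq_mul, mul_one]
    nlinarith [sq_abs r, abs_nonneg r]
  have hp : 0 ≤ (z - (2 : ℝ) • e) ⬝ᵥ (z - (2 : ℝ) • e) :=
    Finset.sum_nonneg fun i _ => mul_self_nonneg _
  simp only [sub_dotProduct, dotProduct_sub, smul_dotProduct, dotProduct_smul,
    smul_eq_mul, dotProduct_comm e z] at hp ⊢
  nlinarith

end Isotropic

theorem mul_exp_neg_half_sq_le (x : ℝ) :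
    x * Real.exp (-(1 / 2) * x ^ 2) ≤ Real.exp (-(1 / 4) * x ^ 2) := by
  have h1 : x ≤ Real.exp (1 / 4 * x ^ 2) := by
    nlinarith [Real.add_one_le_exp (1 / 4 * x ^ 2), sq_nonneg (x / 2 - 1)]
  calc x * Real.exp (-(1 / 2) * x ^ 2)
      ≤ Real.exp (1 / 4 * x ^ 2) * Real.exp (-(1 / 2) * x ^ 2) := by gcongr
    _ = _ := by rw [← Real.exp_add]; ring_nf

/-! ### The covariance matrix -/

variable {D : ℕ} {C : ℝ → Matrix (Fin D) (Fin D) ℝ}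

theorem continuous_mul_transpose_apply (hC : Continuous C) (i j : Fin D) :
    Continuous fun u => (C u * (C u)ᵀ) i j :=
  (hC.matrix_mul hC.matrix_transpose).matrix_elem i j

theorem Sig_isSymm (C : ℝ → Matrix (Fin D) (Fin D) ℝ) (t s : ℝ) : (Sig C t s).IsSymm := by
  ext i j
  simp only [Matrix.transpose_apply, Sig]
  congr 1
  ext u
  simp [Matrix.mul_apply, mul_comm]

theorem continuous_Sig (hC : Continuous C) (t : ℝ) : Continuous fun s => Sig C t s :=
  continuous_matrix fun i j => intervalIntegral.continuous_primitive
    (fun a b => (continuous_mul_transpose_apply hC i j).intervalIntegrable a b) t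

theorem dotProduct_Sig_mulVec (hC : Continuous C) (t s : ℝ) (y : Fin D → ℝ) :
    y ⬝ᵥ Sig C t s *ᵥ y = ∫ u in t..s, ∑ i, ∑ j, y i * (C u * (C u)ᵀ) i j * y j := by
  have hc := continuous_mul_transpose_apply hC
  rw [intervalIntegral.integral_finsetSum fun i _ =>
    Continuous.intervalIntegrable (by fun_prop) _ _]
  refine Finset.sum_congr rfl fun i _ => ?_
  rw [intervalIntegral.integral_finsetSum fun j _ =>
    Continuous.intervalIntegrable (by fun_prop) _ _, Matrix.mulVec, dotProduct, Finset.mul_sum]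
  refine Finset.sum_congr rfl fun j _ => ?_
  rw [intervalIntegral.integral_mul_const, intervalIntegral.integral_const_mul, Sig, mul_assoc]

theorem Sig_bounds {δ δ' t s : ℝ} (hC : Continuous C) (hE : Ellip D δ δ' C) (ht : 0 ≤ t)
    (hts : t ≤ s) (hs : s ≤ 1) (y : Fin D → ℝ) :
    δ * (s - t) * (y ⬝ᵥ y) ≤ y ⬝ᵥ Sig C t s *ᵥ y ∧
      y ⬝ᵥ Sig C t s *ᵥ y ≤ δ' * (s - t) * (y ⬝ᵥ y) := by
  have hy : y ⬝ᵥ y = ∑ i, y i ^ 2 := by simp only [dotProduct, sq]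
  have hc := continuous_mul_transpose_apply hC
  have hint : IntervalIntegrable (fun u => ∑ i, ∑ j, y i * (C u * (C u)ᵀ) i j * y j)
      volume t s := Continuous.intervalIntegrable (by fun_prop) _ _
  have hmem : ∀ u ∈ Set.Icc t s, u ∈ Set.Icc (0 : ℝ) 1 := fun u hu =>
    ⟨ht.trans hu.1, hu.2.trans hs⟩
  rw [dotProduct_Sig_mulVec hC, hy]
  constructor
  · have := intervalIntegral.integral_mono_on hts
      (intervalIntegrable_const (c := δ * ∑ i, y i ^ 2)) hint fun u hu => (hE u (hmem u hu) y).1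
    rw [intervalIntegral.integral_const, smul_eq_mul] at this
    linarith
  · have := intervalIntegral.integral_mono_on hts hint
      (intervalIntegrable_const (c := δ' * ∑ i, y i ^ 2)) fun u hu => (hE u (hmem u hu) y).2
    rw [intervalIntegral.integral_const, smul_eq_mul] at this
    linarith

/-! ### The kernel and its partial derivative -/

theorem Gam_eq (C : ℝ → Matrix (Fin D) (Fin D) ℝ) (t s : ℝ) (z : Fin D → ℝ) :
    Gam C t s z = Real.exp (-(1 / 2) * (z ⬝ᵥ (Sig C t s)⁻¹ *ᵥ z)) /
      ((2 * π) ^ ((D : ℝ) / 2) * √(Sig C t s).det) := by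
  simp only [Gam, dotProduct, Matrix.mulVec, Finset.mul_sum, mul_assoc]

/-- The partial derivative of `Gam C t s` in the `d`-th coordinate. -/
def dGam (C : ℝ → Matrix (Fin D) (Fin D) ℝ) (t s : ℝ) (d : Fin D) (z : Fin D → ℝ) : ℝ :=
  -((Sig C t s)⁻¹ *ᵥ z) d * Gam C t s z

theorem differentiable_Gam (C : ℝ → Matrix (Fin D) (Fin D) ℝ) (t s : ℝ) :
    Differentiable ℝ fun z => Gam C t s z := by
  unfold Gam
  fun_prop

theorem hasLineDerivAt_Gam (C : ℝ → Matrix (Fin D) (Fin D) ℝ) (t s : ℝ) (d : Fin D)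
    (z : Fin D → ℝ) :
    HasLineDerivAt ℝ (fun z => Gam C t s z) (dGam C t s d z) z (Pi.single d 1) := by
  set B := (Sig C t s)⁻¹ with hB
  have hBs : B.IsSymm := by
    rw [Matrix.IsSymm, hB, Matrix.transpose_nonsing_inv, (Sig_isSymm C t s).eq]
  have hq : ∀ r : ℝ, (z + r • Pi.single d (1 : ℝ)) ⬝ᵥ B *ᵥ (z + r • Pi.single d (1 : ℝ)) =
      z ⬝ᵥ B *ᵥ z + r * (2 * (B *ᵥ z) d) +
        r ^ 2 * ((Pi.single d (1 : ℝ)) ⬝ᵥ B *ᵥ (Pi.single d (1 : ℝ))) := by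
    intro r
    have hx := dotProduct_mulVec_symm hBs z (Pi.single d (1 : ℝ))
    have hy : (Pi.single d (1 : ℝ)) ⬝ᵥ B *ᵥ z = (B *ᵥ z) d := by simp [single_dotProduct]
    simp only [Matrix.mulVec_add, Matrix.mulVec_smul, add_dotProduct, dotProduct_add,
      smul_dotProduct, dotProduct_smul, smul_eq_mul, hx, hy]
    ring
  simp only [HasLineDerivAt, dGam, Gam_eq, ← hB, hq]
  set c := (Pi.single d (1 : ℝ)) ⬝ᵥ B *ᵥ (Pi.single d (1 : ℝ))
  have h1 : HasDerivAt (fun r : ℝ => -(1 / 2) * (z ⬝ᵥ B *ᵥ z + r * (2 * (B *ᵥ z) d) + r ^ 2 * c))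
      (-(B *ᵥ z) d) 0 := by
    have := ((((hasDerivAt_id (0 : ℝ)).mul_const (2 * (B *ᵥ z) d)).const_add
      (z ⬝ᵥ B *ᵥ z)).add ((hasDerivAt_pow 2 (0 : ℝ)).mul_const c)).const_mul (-(1 / 2) : ℝ)
    refine this.congr_deriv ?_
    simp
  refine (h1.exp.div_const _).congr_deriv ?_
  simp
  ring

theorem fderiv_Gam_apply (C : ℝ → Matrix (Fin D) (Fin D) ℝ) (t s : ℝ) (d : Fin D)
    (z : Fin D → ℝ) :
    fderiv ℝ (fun z => Gam C t s z) z (Pi.single d 1) = dGam C t s d z := by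
  rw [← (differentiable_Gam C t s z).lineDeriv_eq_fderiv]
  exact (hasLineDerivAt_Gam C t s d z).lineDeriv

theorem hasDerivAt_Gam_sub (C : ℝ → Matrix (Fin D) (Fin D) ℝ) (t s : ℝ) (d : Fin D)
    (z : Fin D → ℝ) (r : ℝ) :
    HasDerivAt (fun r : ℝ => Gam C t s (z - r • Pi.single d 1))
      (-dGam C t s d (z - r • Pi.single d 1)) r := by
  have h := (differentiable_Gam C t s (z - r • Pi.single d 1)).hasFDerivAt.comp_hasDerivAt r
    (((hasDerivAt_id r).smul_const (Pi.single d (1 : ℝ))).const_sub z)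
  refine h.congr_deriv ?_
  rw [one_smul, map_neg, fderiv_Gam_apply]

theorem measurable_inv_Sig_apply (hC : Continuous C) (t : ℝ) (i j : Fin D) :
    Measurable fun s => (Sig C t s)⁻¹ i j := by
  have hS := continuous_Sig hC t
  simp only [Matrix.inv_def, Matrix.smul_apply, Ring.inverse_eq_inv', smul_eq_mul]
  exact hS.matrix_det.measurable.inv.mul (hS.matrix_adjugate.matrix_elem i j).measurable

theorem measurable_Gam (hC : Continuous C) (t : ℝ) :
    Measurable fun p : ℝ × (Fin D → ℝ) => Gam C t p.1 p.2 := by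
  have h1 := measurable_inv_Sig_apply hC t
  have h2 := (continuous_Sig hC t).matrix_det.measurable
  have hz : ∀ i, Measurable fun p : ℝ × (Fin D → ℝ) => p.2 i := fun i =>
    (measurable_pi_apply i).comp measurable_snd
  have hq : Measurable fun p : ℝ × (Fin D → ℝ) =>
      ∑ i, ∑ j, p.2 i * (Sig C t p.1)⁻¹ i j * p.2 j :=
    Finset.measurable_fun_sum _ fun i _ => Finset.measurable_fun_sum _ fun j _ =>
      ((hz i).mul ((h1 i j).comp measurable_fst)).mul (hz j)
  exact (hq.const_mul _).exp.div ((h2.comp measurable_fst).sqrt.const_mul _)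

theorem measurable_dGam (hC : Continuous C) (t : ℝ) (d : Fin D) :
    Measurable fun p : ℝ × (Fin D → ℝ) => dGam C t p.1 d p.2 := by
  have h1 := measurable_inv_Sig_apply hC t
  have hw : Measurable fun p : ℝ × (Fin D → ℝ) => ∑ j, (Sig C t p.1)⁻¹ d j * p.2 j :=
    Finset.measurable_fun_sum _ fun j _ => ((h1 d j).comp measurable_fst).mul
      ((measurable_pi_apply j).comp measurable_snd)
  exact hw.neg.mul (measurable_Gam hC t)

section Bounds

variable {δ δ' t s : ℝ}

/-- An isotropic Gaussian dominating `Gam C t s`. -/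
def domGauss (D : ℕ) (δ δ' τ : ℝ) (z : Fin D → ℝ) : ℝ :=
  Real.exp (-(1 / (4 * (δ' * τ))) * (z ⬝ᵥ z)) / ((2 * π) ^ ((D : ℝ) / 2) * √(δ * τ) ^ D)

theorem integrable_domGauss {τ : ℝ} (hδ' : 0 < δ') (hτ : 0 < τ) :
    Integrable (domGauss D δ δ' τ) := by
  unfold domGauss
  exact (integrable_exp_neg_mul_dotProduct (by positivity)).div_const _

theorem integral_domGauss {τ : ℝ} (hδ : 0 < δ) (hδ' : 0 < δ') (hτ : 0 < τ) :
    ∫ z, domGauss D δ δ' τ z = √(4 * π * δ' / δ) ^ D / (2 * π) ^ ((D : ℝ) / 2) := by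
  simp only [domGauss]
  rw [integral_div, integral_exp_neg_mul_dotProduct]
  have h : √(π / (1 / (4 * (δ' * τ)))) = √(4 * π * δ' / δ) * √(δ * τ) := by
    rw [← Real.sqrt_mul (by positivity)]
    congr 1
    field_simp
  rw [h, mul_pow]
  have : 0 < √(δ * τ) := Real.sqrt_pos.2 (by positivity)
  field_simp

theorem exp_div_le_domGauss (hδ : 0 < δ) (hδ' : 0 < δ') (hC : Continuous C)
    (hE : Ellip D δ δ' C) (ht : 0 ≤ t) (hts : t < s) (hs : s ≤ 1) (z : Fin D → ℝ) :
    Real.exp (-(1 / 4) * (z ⬝ᵥ (Sig C t s)⁻¹ *ᵥ z)) /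
      ((2 * π) ^ ((D : ℝ) / 2) * √(Sig C t s).det) ≤ domGauss D δ δ' (s - t) z := by
  have hτ : 0 < s - t := sub_pos.2 hts
  have ha : 0 < δ * (s - t) := by positivity
  have hb : 0 < δ' * (s - t) := by positivity
  have hbd := Sig_bounds hC hE ht hts.le hs
  have hdet := pow_card_le_det (Sig_isSymm C t s) ha fun y => (hbd y).1
  rw [Fintype.card_fin] at hdet
  have hpos : 0 < (Sig C t s).det := lt_of_lt_of_le (by positivity) hdet
  have hq := dotProduct_self_div_le (Sig_isSymm C t s) hpos ha.le hb (fun y => (hbd y).1)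
    (fun y => (hbd y).2) z
  have hsq : √(δ * (s - t)) ^ D ≤ √(Sig C t s).det := by
    refine Real.le_sqrt_of_sq_le ?_
    rwa [← pow_mul, mul_comm D, pow_mul, Real.sq_sqrt ha.le]
  have hr : 0 < √(δ * (s - t)) := Real.sqrt_pos.2 ha
  refine div_le_div₀ (Real.exp_nonneg _) (Real.exp_le_exp.2 ?_) (by positivity)
    (mul_le_mul_of_nonneg_left hsq (by positivity))
  calc -(1 / 4) * (z ⬝ᵥ (Sig C t s)⁻¹ *ᵥ z) ≤ -(1 / 4) * ((z ⬝ᵥ z) / (δ' * (s - t))) := by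
        linarith
    _ = _ := by field_simp

theorem abs_Gam_le (hδ : 0 < δ) (hδ' : 0 < δ') (hC : Continuous C) (hE : Ellip D δ δ' C)
    (ht : 0 ≤ t) (hts : t < s) (hs : s ≤ 1) (z : Fin D → ℝ) :
    |Gam C t s z| ≤ domGauss D δ δ' (s - t) z := by
  refine le_trans ?_ (exp_div_le_domGauss hδ hδ' hC hE ht hts hs z)
  have hτ : 0 < s - t := sub_pos.2 hts
  have ha : 0 < δ * (s - t) := by positivity
  have hbd := Sig_bounds hC hE ht hts.le hs
  have hpos : 0 < (Sig C t s).det := lt_of_lt_of_le (by positivity)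
    (pow_card_le_det (Sig_isSymm C t s) ha fun y => (hbd y).1)
  rw [Gam_eq, abs_of_nonneg (by positivity)]
  have hq : 0 ≤ z ⬝ᵥ (Sig C t s)⁻¹ *ᵥ z := le_trans
    (div_nonneg (Finset.sum_nonneg fun i _ => mul_self_nonneg _) (by positivity))
    (dotProduct_self_div_le (Sig_isSymm C t s) hpos ha.le (b := δ' * (s - t)) (by positivity)
      (fun y => (hbd y).1) (fun y => (hbd y).2) z)
  gcongr
  norm_num

theorem abs_dGam_le (hδ : 0 < δ) (hδ' : 0 < δ') (hC : Continuous C) (hE : Ellip D δ δ' C)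
    (ht : 0 ≤ t) (hts : t < s) (hs : s ≤ 1) (d : Fin D) (z : Fin D → ℝ) :
    |dGam C t s d z| ≤ (√(δ * (s - t)))⁻¹ * domGauss D δ δ' (s - t) z := by
  have hτ : 0 < s - t := sub_pos.2 hts
  have ha : 0 < δ * (s - t) := by positivity
  have hbd := Sig_bounds hC hE ht hts.le hs
  have hpos : 0 < (Sig C t s).det := lt_of_lt_of_le (by positivity)
    (pow_card_le_det (Sig_isSymm C t s) ha fun y => (hbd y).1)
  have hw := mul_sq_inv_mulVec_le hpos ha (fun y => (hbd y).1) z d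
  set Q := z ⬝ᵥ (Sig C t s)⁻¹ *ᵥ z with hQ
  have hQ0 : 0 ≤ Q := le_trans (by positivity) hw
  have hr : 0 < √(δ * (s - t)) := Real.sqrt_pos.2 ha
  have h1 : |((Sig C t s)⁻¹ *ᵥ z) d| ≤ (√(δ * (s - t)))⁻¹ * √Q := by
    rw [le_inv_mul_iff₀ hr]
    refine Real.le_sqrt_of_sq_le ?_
    rwa [mul_pow, Real.sq_sqrt ha.le, sq_abs]
  have h2 : √Q * Real.exp (-(1 / 2) * Q) ≤ Real.exp (-(1 / 4) * Q) := by
    have := mul_exp_neg_half_sq_le (√Q)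
    rwa [Real.sq_sqrt hQ0] at this
  set N := (2 * π) ^ ((D : ℝ) / 2) * √(Sig C t s).det with hN
  have hN0 : 0 ≤ N := by positivity
  have h3 := exp_div_le_domGauss hδ hδ' hC hE ht hts hs z
  rw [← hQ, ← hN] at h3
  rw [dGam, abs_mul, abs_neg, Gam_eq, ← hQ, ← hN, abs_of_nonneg (a := _ / _) (by positivity)]
  calc |((Sig C t s)⁻¹ *ᵥ z) d| * (Real.exp (-(1 / 2) * Q) / N)
      ≤ (√(δ * (s - t)))⁻¹ * √Q * (Real.exp (-(1 / 2) * Q) / N) := by gcongr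
    _ = (√(δ * (s - t)))⁻¹ * ((√Q * Real.exp (-(1 / 2) * Q)) / N) := by ring
    _ ≤ (√(δ * (s - t)))⁻¹ * (Real.exp (-(1 / 4) * Q) / N) := by gcongr
    _ ≤ _ := by gcongr

end Bounds

/-! ### Differentiation under the spatial integral -/

section Convolution

variable {δ δ' t s M : ℝ} {g : (Fin D → ℝ) → ℝ}

theorem abs_integral_mul_le {k m : (Fin D → ℝ) → ℝ} (hm : Integrable m)
    (hk : ∀ z, |k z| ≤ m z) (hg : ∀ x, |g x| ≤ M) (y : Fin D → ℝ) :
    |∫ x, k (x - y) * g x| ≤ (∫ z, m z) * M := by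
  have h := norm_integral_le_of_norm_le (f := fun x => k (x - y) * g x)
    (g := fun x => m (x - y) * M) ((hm.comp_sub_right y).mul_const M)
    (Filter.Eventually.of_forall fun x => by
      rw [Real.norm_eq_abs, abs_mul]
      exact mul_le_mul (hk _) (hg _) (abs_nonneg _) ((abs_nonneg _).trans (hk _)))
  rwa [integral_mul_const, integral_sub_right_eq_self] at h

theorem hasDerivAt_integral_translate {k k' : (Fin D → ℝ) → ℝ} {A c : ℝ} {d : Fin D}
    (hk : Integrable k) (hkm : Measurable k) (hkm' : Measurable k') (hA : 0 ≤ A) (hc : 0 < c)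
    (hbd : ∀ z, |k' z| ≤ A * Real.exp (-c * (z ⬝ᵥ z)))
    (hder : ∀ z r, HasDerivAt (fun r : ℝ => k (z - r • Pi.single d 1))
      (-k' (z - r • Pi.single d 1)) r)
    (hgm : AEStronglyMeasurable g) (hg : ∀ x, |g x| ≤ M) (y : Fin D → ℝ) (r₀ : ℝ) :
    HasDerivAt (fun r : ℝ => ∫ x, k (x - (y + r • Pi.single d 1)) * g x)
      (-∫ x, k' (x - (y + r₀ • Pi.single d 1)) * g x) r₀ := by
  set y₀ := y + r₀ • Pi.single d (1 : ℝ) with hy₀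
  rw [← integral_neg]
  refine (hasDerivAt_integral_of_dominated_loc_of_deriv_le
    (F := fun r x => k (x - (y + r • Pi.single d 1)) * g x)
    (F' := fun r x => -(k' (x - (y + r • Pi.single d 1)) * g x))
    (bound := fun x => A *
      (Real.exp c * Real.exp (-(c / 2) * ((x - y₀) ⬝ᵥ (x - y₀)))) * M)
    (Metric.ball_mem_nhds r₀ one_pos) ?_ ?_ ?_ ?_ ?_ ?_).2
  · exact Filter.Eventually.of_forall fun r =>
      (hkm.comp (measurable_id.sub_const _)).aestronglyMeasurable.mul hgm
  · exact (hk.comp_sub_right y₀).mul_bdd (c := M) hgm (Filter.Eventually.of_forall hg)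
  · exact ((hkm'.comp (measurable_id.sub_const _)).aestronglyMeasurable.mul hgm).neg
  · refine Filter.Eventually.of_forall fun x r hr => ?_
    rw [norm_neg, Real.norm_eq_abs, abs_mul]
    refine mul_le_mul ((hbd _).trans ?_) (hg x) (abs_nonneg _) (by positivity)
    have hx : x - (y + r • Pi.single d (1 : ℝ)) = (x - y₀) - (r - r₀) • Pi.single d (1 : ℝ) := by
      rw [hy₀, sub_smul]; abel
    rw [hx]
    refine mul_le_mul_of_nonneg_left (exp_neg_mul_dotProduct_sub_le hc.le ?_ d _) hA
    rw [← Real.dist_eq]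
    exact (Metric.mem_ball.1 hr).le
  · exact ((((integrable_exp_neg_mul_dotProduct (half_pos hc)).comp_sub_right y₀).const_mul
      _).const_mul _).mul_const _
  · refine Filter.Eventually.of_forall fun x r _ => ?_
    have h := (hder (x - y) r).mul_const (g x)
    simpa only [sub_sub, neg_mul] using h

theorem hasDerivAt_integral_Gam (hδ : 0 < δ) (hδ' : 0 < δ') (hC : Continuous C)
    (hE : Ellip D δ δ' C) (ht : 0 ≤ t) (hts : t < s) (hs : s ≤ 1)
    (hgm : AEStronglyMeasurable g) (hg : ∀ x, |g x| ≤ M) (d : Fin D) (y : Fin D → ℝ) (r₀ : ℝ) :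
    HasDerivAt (fun r : ℝ => ∫ x, Gam C t s (x - (y + r • Pi.single d 1)) * g x)
      (-∫ x, dGam C t s d (x - (y + r₀ • Pi.single d 1)) * g x) r₀ := by
  have hτ : 0 < s - t := sub_pos.2 hts
  have hG : Measurable (Gam C t s) := (differentiable_Gam C t s).continuous.measurable
  have hG' : Measurable (dGam C t s d) :=
    Measurable.of_uncurry_left (f := fun s z => dGam C t s d z) (measurable_dGam hC t d)
  refine hasDerivAt_integral_translate (c := 1 / (4 * (δ' * (s - t))))
    (A := (√(δ * (s - t)))⁻¹ / ((2 * π) ^ ((D : ℝ) / 2) * √(δ * (s - t)) ^ D))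
    ((integrable_domGauss hδ' hτ).mono' hG.aestronglyMeasurable
      (Filter.Eventually.of_forall (abs_Gam_le hδ hδ' hC hE ht hts hs)))
    hG hG' (by positivity) (by positivity) (fun z => ?_) (hasDerivAt_Gam_sub C t s d) hgm hg y r₀
  refine (abs_dGam_le hδ hδ' hC hE ht hts hs d z).trans_eq ?_
  rw [domGauss]
  ring

end Convolution

/-- The map `s ↦ ∫ k(s, x - y) f(s, x) dx` is measurable on `(t, T]`. -/
theorem aestronglyMeasurable_integral_mul {t T : ℝ} (ht : 0 ≤ t)
    {k f : ℝ → (Fin D → ℝ) → ℝ} (hk : Measurable fun p : ℝ × (Fin D → ℝ) => k p.1 p.2)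
    (hf : ContinuousOn (fun p : ℝ × (Fin D → ℝ) => f p.1 p.2) (Set.Icc 0 T ×ˢ Set.univ))
    (y : Fin D → ℝ) :
    AEStronglyMeasurable (fun s => ∫ x, k s (x - y) * f s x) (volume.restrict (Set.Ioc t T)) := by
  refine AEStronglyMeasurable.integral_prod_right'
    (f := fun p : ℝ × (Fin D → ℝ) => k p.1 (p.2 - y) * f p.1 p.2) ?_
  have h1 : (volume.restrict (Set.Ioc t T)).prod (volume : Measure (Fin D → ℝ)) =
      (volume.prod volume).restrict (Set.Ioc t T ×ˢ Set.univ) := by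
    rw [← Measure.prod_restrict, Measure.restrict_univ]
  have hsub : Set.Ioc t T ×ˢ (Set.univ : Set (Fin D → ℝ)) ⊆ Set.Icc 0 T ×ˢ Set.univ :=
    Set.prod_mono (fun u hu => ⟨ht.trans hu.1.le, hu.2⟩) subset_rfl
  rw [h1]
  refine AEStronglyMeasurable.mul ?_ ((hf.mono hsub).aestronglyMeasurable
    (measurableSet_Ioc.prod MeasurableSet.univ))
  exact (hk.comp (measurable_fst.prodMk (measurable_snd.sub_const y))).aestronglyMeasurable

theorem intervalIntegrable_inv_sqrt_mul_sub {δ t T : ℝ} (hδ : 0 < δ) (htT : t ≤ T) :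
    IntervalIntegrable (fun s => (√(δ * (s - t)))⁻¹) volume t T := by
  have h : IntervalIntegrable (fun x : ℝ => x ^ (-(1 / 2) : ℝ)) volume (t - t) (T - t) :=
    intervalIntegral.intervalIntegrable_rpow' (by norm_num)
  have h2 := (h.comp_sub_right t).const_mul (√δ)⁻¹
  simp only [sub_add_cancel] at h2
  refine h2.congr fun s hs => ?_
  rw [Set.uIoc_of_le htT] at hs
  have hst : 0 ≤ s - t := (sub_pos.2 hs.1).le
  rw [Real.sqrt_mul hδ.le, mul_inv, Real.rpow_neg hst, ← Real.sqrt_eq_rpow]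

end GaussKernel

theorem stmt6 (D : ℕ) (δ δ' : ℝ) (hδ : 0 < δ) (hδδ : δ ≤ δ')
    (C : ℝ → Matrix (Fin D) (Fin D) ℝ) (hC : Continuous C) (hE : Ellip D δ δ' C)
    (T α : ℝ) (hT : T ∈ Set.Ioc (0:ℝ) 1) (hα : α ∈ Set.Ioo (0:ℝ) 1)
    (f₀ : ℝ → (Fin D → ℝ) → ℝ)
    (hbd : ∃ M, ∀ s ∈ Set.Icc (0:ℝ) T, ∀ x, |f₀ s x| ≤ M)
    (hcont : ContinuousOn (fun p : ℝ × (Fin D → ℝ) => f₀ p.1 p.2)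
      (Set.Icc 0 T ×ˢ Set.univ))
    (hhol : ∃ K, ∀ t ∈ Set.Icc (0:ℝ) T, ∀ s ∈ Set.Icc (0:ℝ) T, ∀ x y : Fin D → ℝ,
      |f₀ t x - f₀ s y| ≤ K * (Real.sqrt |t - s| + en (x - y)) ^ α)
    (t : ℝ) (ht : 0 ≤ t) (htT : t < T) (d : Fin D) (y : Fin D → ℝ) :
    HasLineDerivAt ℝ
      (fun y' => ∫ s in t..T, ∫ x : Fin D → ℝ, Gam C t s (x - y') * f₀ s x)
      (-(∫ s in t..T, ∫ x : Fin D → ℝ,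
          fderiv ℝ (fun z => Gam C t s z) (x - y) (Pi.single d 1) * f₀ s x))
      y (Pi.single d 1) := by
  open MeasureTheory GaussKernel in
  obtain ⟨M, hM⟩ := hbd
  have hδ' : 0 < δ' := hδ.trans_le hδδ
  simp only [fderiv_Gam_apply]
  set K := √(4 * π * δ' / δ) ^ D / (2 * π) ^ ((D : ℝ) / 2)
  have hI : Set.uIoc t T = Set.Ioc t T := Set.uIoc_of_le htT.le
  have hsT : ∀ s ∈ Set.Ioc t T, s ∈ Set.Icc (0 : ℝ) T ∧ s ≤ 1 := fun s hs =>
    ⟨⟨ht.trans hs.1.le, hs.2⟩, hs.2.trans hT.2⟩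
  have hmeas : ∀ y', AEStronglyMeasurable (fun s => ∫ x, Gam C t s (x - y') * f₀ s x)
      (volume.restrict (Set.Ioc t T)) :=
    fun y' => aestronglyMeasurable_integral_mul ht (measurable_Gam hC t) hcont y'
  have hK_int : ∀ s ∈ Set.Ioc t T, ∫ z, domGauss D δ δ' (s - t) z = K := fun s hs =>
    integral_domGauss hδ hδ' (sub_pos.2 hs.1)
  have main := (intervalIntegral.hasDerivAt_integral_of_dominated_loc_of_deriv_le
    (μ := volume) (a := t) (b := T) (x₀ := (0 : ℝ)) (s := Set.univ)
    (F := fun r s => ∫ x, Gam C t s (x - (y + r • Pi.single d 1)) * f₀ s x)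
    (F' := fun r s => -∫ x, dGam C t s d (x - (y + r • Pi.single d 1)) * f₀ s x)
    (bound := fun s => (√(δ * (s - t)))⁻¹ * (K * M))
    Filter.univ_mem ?_ ?_ ?_ ?_ ?_ ?_).2
  · simpa only [HasLineDerivAt, intervalIntegral.integral_neg, zero_smul, add_zero] using main
  · exact Filter.Eventually.of_forall fun r => by rw [hI]; exact hmeas _
  · refine (intervalIntegrable_const (c := K * M)).mono_fun (by rw [hI]; exact hmeas _) ?_
    rw [hI]
    refine (ae_restrict_iff' measurableSet_Ioc).2 (Filter.Eventually.of_forall fun s hs => ?_)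
    have h := abs_integral_mul_le (integrable_domGauss hδ' (sub_pos.2 hs.1))
      (abs_Gam_le hδ hδ' hC hE ht hs.1 (hsT s hs).2) (hM s (hsT s hs).1)
      (y + (0 : ℝ) • Pi.single d 1)
    rw [hK_int s hs] at h
    exact h.trans (le_abs_self _)
  · rw [hI]
    exact (aestronglyMeasurable_integral_mul ht (measurable_dGam hC t d) hcont _).neg
  · refine Filter.Eventually.of_forall fun s hs r _ => ?_
    rw [hI] at hs
    have h := abs_integral_mul_le
      ((integrable_domGauss (D := D) (δ := δ) hδ' (sub_pos.2 hs.1)).const_mul (√(δ * (s - t)))⁻¹)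
      (abs_dGam_le hδ hδ' hC hE ht hs.1 (hsT s hs).2 d) (hM s (hsT s hs).1)
      (y + r • Pi.single d 1)
    rw [integral_const_mul, hK_int s hs, mul_assoc] at h
    rwa [norm_neg, Real.norm_eq_abs]
  · exact (intervalIntegrable_inv_sqrt_mul_sub hδ htT.le).mul_const _
  · refine Filter.Eventually.of_forall fun s hs r _ => ?_
    rw [hI] at hs
    have hg : Continuous (f₀ s) := by
      rw [← continuousOn_univ]
      exact hcont.comp (f := fun x => (s, x)) (by fun_prop) fun x _ => ⟨(hsT s hs).1, trivial⟩
    exact hasDerivAt_integral_Gam hδ hδ' hC hE ht hs.1 (hsT s hs).2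
      hg.aestronglyMeasurable (hM s (hsT s hs).1) d y r
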